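/- arXiv:math/0510303 — 7 statements merged into one kernel-verified Lean document; each statement's English description precedes it below -/
import Mathlib

section
/- For every join-semilattice S with zero, the set R(S) of reduced subsets of C(S), with the given partial order, is a join-semilattice with zero, and the map sending each x ∈ S to {(x,x,x)} is a ∨,0-embedding of S into R(S). -/
section ReducedConstruction

variable {S : Type*} [SemilatticeSup S] [OrderBot S]

/-- `x` is a reduced finite subset of `C(S) = {(u,v,w) : w ≤ u ⊔ v}`. -/
def IsReducedSet (x : Set (S × S × S)) : Prop :=
  x.Finite ∧
  (∀ t ∈ x, t.2.2 ≤ t.1 ⊔ t.2.1) ∧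
  (∃! u : S, (u, u, u) ∈ x) ∧
  (∀ u v w : S, (u, v, w) ∈ x → (v, u, w) ∈ x → u = v ∧ v = w) ∧
  (∀ p u v w : S, (p, p, p) ∈ x → (u, v, w) ∈ x → (u, v, w) ≠ (p, p, p) →
    ¬u ≤ p ∧ ¬v ≤ p ∧ ¬w ≤ p)

/-- `R(S)`: the set of all reduced subsets of `C(S)`. -/
def RSet (S : Type*) [SemilatticeSup S] [OrderBot S] := {x : Set (S × S × S) // IsReducedSet x}

/-- `π(y)`: the coordinate of the unique diagonal triple of the reduced set `y`. -/
noncomputable def piR (y : RSet S) : S := y.2.2.2.1.exists.choose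

/-- The partial order of `R(S)`. -/
def Rle (x y : RSet S) : Prop :=
  ∀ t ∈ x.1 \ y.1, t.1 ≤ piR y ∨ t.2.2 ≤ piR y

lemma isReduced_singleton (a : S) : IsReducedSet ({(a, a, a)} : Set (S × S × S)) := by
  refine ⟨Set.finite_singleton _, ?_, ⟨a, rfl, ?_⟩, ?_, ?_⟩
  · intro t ht
    rw [Set.mem_singleton_iff] at ht
    subst ht
    exact le_sup_left
  · intro u hu
    rw [Set.mem_singleton_iff, Prod.mk.injEq, Prod.mk.injEq] at hu
    exact hu.1
  · intro u v w hu _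
    rw [Set.mem_singleton_iff, Prod.mk.injEq, Prod.mk.injEq] at hu
    obtain ⟨h1, h2, h3⟩ := hu
    exact ⟨h1.trans h2.symm, h2.trans h3.symm⟩
  · intro p u v w hp hu hne
    rw [Set.mem_singleton_iff] at hp hu
    exact absurd (hu.trans hp.symm) hne

/-- The identification of `S` with a subset of `R(S)`, via `a ↦ {(a,a,a)}`. -/
def toRSet (a : S) : RSet S := ⟨{(a, a, a)}, isReduced_singleton a⟩

lemma isReduced_pair {u v w : S} (h : w ≤ u ⊔ v)
    (h1 : ¬(u = v ∨ v = ⊥ ∨ w = ⊥)) (hu0 : u ≠ ⊥) :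
    IsReducedSet ({((⊥ : S), (⊥ : S), (⊥ : S)), (u, v, w)} : Set (S × S × S)) := by
  push_neg at h1
  obtain ⟨huv, hv0, hw0⟩ := h1
  refine ⟨(Set.finite_singleton _).insert _, ?_, ⟨⊥, Set.mem_insert _ _, ?_⟩, ?_, ?_⟩
  · intro t ht
    simp only [Set.mem_insert_iff, Set.mem_singleton_iff] at ht
    rcases ht with rfl | rfl
    · exact bot_le
    · exact h
  · intro q hq
    simp only [Set.mem_insert_iff, Set.mem_singleton_iff, Prod.mk.injEq] at hq
    rcases hq with ⟨hq1, _, _⟩ | ⟨hq1, hq2, _⟩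
    · exact hq1
    · exact absurd (hq1.symm.trans hq2) huv
  · intro p q r hp hq
    simp only [Set.mem_insert_iff, Set.mem_singleton_iff, Prod.mk.injEq] at hp hq
    rcases hp with ⟨h1, h2, h3⟩ | ⟨h1, h2, h3⟩ <;> rcases hq with ⟨g1, g2, g3⟩ | ⟨g1, g2, g3⟩
    · exact ⟨h1.trans g1.symm, g1.trans h3.symm⟩
    · exact absurd (g1.symm.trans h2) hu0
    · exact absurd (h1.symm.trans g2) hu0
    · exact absurd (h1.symm.trans g2) huv
  · intro p x y z hp ht hne
    simp only [Set.mem_insert_iff, Set.mem_singleton_iff, Prod.mk.injEq] at hp ht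
    have hp0 : p = ⊥ := by
      rcases hp with ⟨e1, _, _⟩ | ⟨e1, e2, _⟩
      · exact e1
      · exact absurd (e1.symm.trans e2) huv
    subst hp0
    rcases ht with ⟨e1, e2, e3⟩ | ⟨e1, e2, e3⟩
    · exact absurd (by rw [e1, e2, e3]) hne
    · subst e1; subst e2; subst e3
      exact ⟨fun hle => hu0 (le_bot_iff.1 hle), fun hle => hv0 (le_bot_iff.1 hle),
        fun hle => hw0 (le_bot_iff.1 hle)⟩

open Classical in
/-- The canonical generators `⋈(u,v,w)` of `R(S)`. -/
noncomputable def bowtie (u v w : S) : RSet S :=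
  if h1 : u = v ∨ v = ⊥ ∨ w = ⊥ then toRSet w
  else if h2 : u = ⊥ then toRSet ⊥
  else if h : w ≤ u ⊔ v then
    ⟨{((⊥ : S), (⊥ : S), (⊥ : S)), (u, v, w)}, isReduced_pair h h1 h2⟩
  else toRSet w

end ReducedConstruction

section ReducedOrder

variable {S : Type*} [SemilatticeSup S] [OrderBot S]

lemma piR_mem (y : RSet S) : (piR y, piR y, piR y) ∈ y.1 :=
  y.2.2.2.1.exists.choose_spec

lemma eq_piR_of_mem {y : RSet S} {a : S} (h : (a, a, a) ∈ y.1) : a = piR y :=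
  y.2.2.2.1.unique h (piR_mem y)

lemma piR_toRSet (a : S) : piR (toRSet a) = a :=
  (eq_piR_of_mem (y := toRSet a) (Set.mem_singleton _)).symm

/-- Every triple of `A` lies in `z` or has its first or last coordinate below `π(z)`. -/
def Dominates (A : Set (S × S × S)) (z : RSet S) : Prop :=
  ∀ u v w : S, (u, v, w) ∈ A → (u, v, w) ∈ z.1 ∨ u ≤ piR z ∨ w ≤ piR z

lemma rle_iff_dominates {x y : RSet S} : Rle x y ↔ Dominates x.1 y := by
  constructor
  · intro h u v w ht
    by_cases hy : (u, v, w) ∈ y.1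
    · exact Or.inl hy
    · exact Or.inr (h _ ⟨ht, hy⟩)
  · rintro h ⟨u, v, w⟩ ⟨ht, hy⟩
    exact (h u v w ht).resolve_left hy

/-- A nondiagonal triple of `z` has no coordinate below `π(z)`, so a triple of `z` with its first or
second coordinate below `π(z)` is the diagonal one. -/
lemma thd_le_piR_of_mem {z : RSet S} {u v w : S} (h : (u, v, w) ∈ z.1)
    (huv : u ≤ piR z ∨ v ≤ piR z) : w ≤ piR z := by
  by_cases hd : (u, v, w) = (piR z, piR z, piR z)
  · simp only [Prod.mk.injEq] at hd
    exact hd.2.2.le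
  · have := z.2.2.2.2.2 _ _ _ _ (piR_mem z) h hd
    exact absurd huv (not_or.2 ⟨this.1, this.2.1⟩)

lemma Dominates.thd_le_of_snd_le {A : Set (S × S × S)} {z : RSet S} (h : Dominates A z)
    {u v w : S} (hA : (u, v, w) ∈ A) (hC : w ≤ u ⊔ v) (hv : v ≤ piR z) : w ≤ piR z := by
  rcases h u v w hA with hz | hu | hw
  · exact thd_le_piR_of_mem hz (Or.inr hv)
  · exact hC.trans (sup_le hu hv)
  · exact hw

lemma Dominates.thd_le_of_swap {A : Set (S × S × S)} {z : RSet S} (h : Dominates A z)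
    {u v w : S} (hA : (u, v, w) ∈ A) (hA' : (v, u, w) ∈ A) (hC : w ≤ u ⊔ v) : w ≤ piR z := by
  rcases h v u w hA' with hz' | hv | hw
  · rcases h u v w hA with hz | hu | hw
    · obtain ⟨rfl, rfl⟩ := z.2.2.2.2.1 u v w hz hz'
      exact (eq_piR_of_mem hz).le
    · exact thd_le_piR_of_mem hz' (Or.inr hu)
    · exact hw
  · exact h.thd_le_of_snd_le hA hC hv
  · exact hw

lemma Rle.piR_le {x y : RSet S} (h : Rle x y) : piR x ≤ piR y := by
  rcases rle_iff_dominates.1 h _ _ _ (piR_mem x) with hy | hp | hp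
  · exact (eq_piR_of_mem hy).le
  · exact hp
  · exact hp

lemma Rle.refl (x : RSet S) : Rle x x := fun _ ht => absurd ht.1 ht.2

lemma Rle.trans {x y z : RSet S} (hxy : Rle x y) (hyz : Rle y z) : Rle x z := by
  rw [rle_iff_dominates] at *
  intro u v w ht
  have hp := (rle_iff_dominates.2 hyz).piR_le
  rcases hxy u v w ht with hy | hu | hw
  · exact hyz u v w hy
  · exact Or.inr (Or.inl (hu.trans hp))
  · exact Or.inr (Or.inr (hw.trans hp))

lemma Rle.subset {x y : RSet S} (hxy : Rle x y) (hp : piR y = piR x) : x.1 ⊆ y.1 := by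
  rintro ⟨u, v, w⟩ ht
  by_cases hd : (u, v, w) = (piR x, piR x, piR x)
  · rw [hd, ← hp]
    exact piR_mem y
  · have hn := x.2.2.2.2.2 _ _ _ _ (piR_mem x) ht hd
    rw [← hp] at hn
    exact (rle_iff_dominates.1 hxy u v w ht).resolve_right (not_or.2 ⟨hn.1, hn.2.2⟩)

lemma Rle.antisymm {x y : RSet S} (hxy : Rle x y) (hyx : Rle y x) : x = y :=
  have hp : piR x = piR y := le_antisymm hxy.piR_le hyx.piR_le
  Subtype.ext ((hxy.subset hp.symm).antisymm (hyx.subset hp))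

lemma toRSet_rle_iff {a : S} {y : RSet S} : Rle (toRSet a) y ↔ a ≤ piR y := by
  constructor
  · intro h
    simpa only [piR_toRSet] using h.piR_le
  · rintro h t ⟨ht, -⟩
    obtain rfl : t = (a, a, a) := ht
    exact Or.inl h

/-- Every finite subset of `C(S)` is dominated by a least reduced set. -/
lemma exists_least_dominates {A : Set (S × S × S)} (hfin : A.Finite)
    (hC : ∀ t ∈ A, t.2.2 ≤ t.1 ⊔ t.2.1) :
    ∃ z : RSet S, Dominates A z ∧ ∀ z', Dominates A z' → Rle z z' := by
  have hBfin : {t ∈ A | ∀ z, Dominates A z → t.2.2 ≤ piR z}.Finite :=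
    hfin.subset (Set.sep_subset _ _)
  obtain ⟨p, hp_sup⟩ : ∃ p, p = hBfin.toFinset.sup (fun t => t.2.2) := ⟨_, rfl⟩
  have p_le : ∀ z, Dominates A z → p ≤ piR z := by
    intro z hz
    rw [hp_sup]
    refine Finset.sup_le fun t ht => ?_
    exact (hBfin.mem_toFinset.1 ht).2 z hz
  have le_p : ∀ u v w, (u, v, w) ∈ A → (∀ z, Dominates A z → w ≤ piR z) → w ≤ p := by
    intro u v w hA h
    rw [hp_sup]
    exact Finset.le_sup (f := fun t : S × S × S => t.2.2) (hBfin.mem_toFinset.2 ⟨hA, h⟩)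
  have hsnd : ∀ u v w, (u, v, w) ∈ A → v ≤ p → w ≤ p := fun u v w hA hv =>
    le_p u v w hA fun z hz => hz.thd_le_of_snd_le hA (hC _ hA) (hv.trans (p_le z hz))
  have hswap : ∀ u v w, (u, v, w) ∈ A → (v, u, w) ∈ A → w ≤ p := fun u v w hA hA' =>
    le_p u v w hA fun z hz => hz.thd_le_of_swap hA hA' (hC _ hA)
  obtain ⟨J, hJ⟩ : ∃ J : Set (S × S × S), J =
      insert (p, p, p) {t ∈ A | ¬t.1 ≤ p ∧ ¬t.2.1 ≤ p ∧ ¬t.2.2 ≤ p} := ⟨_, rfl⟩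
  have mem_J : ∀ u v w, (u, v, w) ∈ J ↔ (u = p ∧ v = p ∧ w = p) ∨
      ((u, v, w) ∈ A ∧ ¬u ≤ p ∧ ¬v ≤ p ∧ ¬w ≤ p) := by
    intro u v w
    simp only [hJ, Set.mem_insert_iff, Set.mem_ofPred_eq, Prod.mk.injEq]
  have diag : ∀ a, (a, a, a) ∈ J → a = p := by
    intro a ha
    rcases (mem_J a a a).1 ha with h | ⟨hA, h⟩
    · exact h.1
    · exact absurd (hswap a a a hA hA) h.1
  have hpJ : (p, p, p) ∈ J := (mem_J p p p).2 (Or.inl ⟨rfl, rfl, rfl⟩)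
  have hred : IsReducedSet J := by
    refine ⟨?_, ?_, ⟨p, hpJ, diag⟩, ?_, ?_⟩
    · rw [hJ]
      exact (hfin.subset (Set.sep_subset _ _)).insert _
    · rintro ⟨u, v, w⟩ ht
      rcases (mem_J u v w).1 ht with ⟨rfl, rfl, rfl⟩ | h
      · exact le_sup_left
      · exact hC _ h.1
    · intro u v w h h'
      rcases (mem_J u v w).1 h with ⟨rfl, rfl, rfl⟩ | ⟨hA, -, -, hw⟩
      · exact ⟨rfl, rfl⟩
      · rcases (mem_J v u w).1 h' with ⟨rfl, rfl, rfl⟩ | ⟨hA', -⟩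
        · exact ⟨rfl, rfl⟩
        · exact absurd (hswap u v w hA hA') hw
    · intro q u v w hq h hne
      obtain rfl := diag q hq
      rcases (mem_J u v w).1 h with ⟨rfl, rfl, rfl⟩ | h
      · exact absurd rfl hne
      · exact h.2
  have hpi : piR ⟨J, hred⟩ = p := (eq_piR_of_mem (y := ⟨J, hred⟩) hpJ).symm
  refine ⟨⟨J, hred⟩, ?_, ?_⟩
  · intro u v w hA
    rw [hpi]
    by_cases hu : u ≤ p
    · exact Or.inr (Or.inl hu)
    by_cases hw : w ≤ p
    · exact Or.inr (Or.inr hw)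
    exact Or.inl ((mem_J u v w).2 (Or.inr ⟨hA, hu, fun hv => hw (hsnd u v w hA hv), hw⟩))
  · intro z hz
    refine rle_iff_dominates.2 fun u v w h => ?_
    rcases (mem_J u v w).1 h with ⟨rfl, rfl, rfl⟩ | h
    · exact Or.inr (Or.inl (p_le z hz))
    · exact hz u v w h.1

lemma exists_rle_lub (x y : RSet S) :
    ∃ z : RSet S, Rle x z ∧ Rle y z ∧ ∀ z', Rle x z' → Rle y z' → Rle z z' := by
  obtain ⟨z, hz, hmin⟩ := exists_least_dominates (A := x.1 ∪ y.1) (x.2.1.union y.2.1)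
    (fun t ht => ht.elim (x.2.2.1 t) (y.2.2.1 t))
  refine ⟨z, rle_iff_dominates.2 fun u v w h => hz u v w (Or.inl h),
    rle_iff_dominates.2 fun u v w h => hz u v w (Or.inr h), fun z' hx hy => hmin z' ?_⟩
  rintro u v w (h | h)
  · exact rle_iff_dominates.1 hx u v w h
  · exact rle_iff_dominates.1 hy u v w h

end ReducedOrder

/-- `R(S)`, with the given partial order, is a `∨,0`-semilattice, and
`x ↦ {(x,x,x)}` is a `∨,0`-embedding of `S` into `R(S)`. -/
theorem RSet_is_semilattice_and_embedding (S : Type*) [SemilatticeSup S] [OrderBot S] :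
    ∃ (instSup : SemilatticeSup (RSet S)) (instBot : OrderBot (RSet S)),
      (∀ x y : RSet S, x ≤ y ↔ Rle x y) ∧
      Function.Injective (toRSet : S → RSet S) ∧
      toRSet (⊥ : S) = (⊥ : RSet S) ∧
      ∀ a b : S, toRSet (a ⊔ b) = toRSet a ⊔ toRSet b := by
  choose sup le_left le_right sup_le' using exists_rle_lub (S := S)
  let instSup : SemilatticeSup (RSet S) :=
    { le := Rle
      le_refl := Rle.refl
      le_trans := fun _ _ _ => Rle.trans
      le_antisymm := fun _ _ => Rle.antisymm
      sup := sup
      le_sup_left := le_left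
      le_sup_right := le_right
      sup_le := fun x y z => sup_le' x y z }
  let instBot : OrderBot (RSet S) :=
    { bot := toRSet ⊥
      bot_le := fun _ => toRSet_rle_iff.2 bot_le }
  refine ⟨instSup, instBot, fun _ _ => Iff.rfl, ?_, rfl, fun a b => ?_⟩
  · exact Function.LeftInverse.injective piR_toRSet
  · apply Rle.antisymm
    · exact toRSet_rle_iff.2 (_root_.sup_le (toRSet_rle_iff.1 (le_left _ _))
        (toRSet_rle_iff.1 (le_right _ _)))
    · apply sup_le' <;> rw [toRSet_rle_iff, piR_toRSet]
      · exact le_sup_left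
      · exact le_sup_right
end

section
/- The assignment S ↦ R(S), f ↦ R(f) is a functor on the category of ∨,0-semilattices with ∨,0-homomorphisms: R of the identity homomorphism on S is the identity on R(S), and R(g ∘ f) = R(g) ∘ R(f) for composable ∨,0-homomorphisms f and g. -/
/-- `g : R(S) → R(T)` is the map `R(f)` associated with the `∨,0`-homomorphism
`f : S → T`: it is a `∨,0`-homomorphism extending `f` and commuting with `⋈`. -/
def IsRMap {S T : Type*} [SemilatticeSup S] [OrderBot S] [SemilatticeSup T] [OrderBot T]
    [SemilatticeSup (RSet S)] [OrderBot (RSet S)]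
    [SemilatticeSup (RSet T)] [OrderBot (RSet T)]
    (f : S → T) (g : RSet S → RSet T) : Prop :=
  g ⊥ = ⊥ ∧ (∀ x y : RSet S, g (x ⊔ y) = g x ⊔ g y) ∧
  (∀ a : S, g (toRSet a) = toRSet (f a)) ∧
  (∀ u v w : S, w ≤ u ⊔ v → g (bowtie u v w) = bowtie (f u) (f v) (f w))

section Generation

variable {S : Type*} [SemilatticeSup S] [OrderBot S]

/-- For a triple of a reduced set, the generator `⋈` contains this triple and, apart from it, at
most the triple `(0,0,0)`. -/
lemma mem_bowtie_and_forall_mem_bowtie (x : RSet S) {t : S × S × S} (ht : t ∈ x.1) :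
    t ∈ (bowtie t.1 t.2.1 t.2.2).1 ∧
      ∀ s ∈ (bowtie t.1 t.2.1 t.2.2).1, s = t ∨ s = (⊥, ⊥, ⊥) := by
  obtain ⟨u, v, w⟩ := t
  obtain ⟨-, hle, ⟨p, hp, -⟩, hsymm, hnot⟩ := x.2
  by_cases huv : u = v
  · subst huv
    obtain ⟨-, rfl⟩ := hsymm _ _ _ ht ht
    simp [bowtie, toRSet]
  · have hne : (u, v, w) ≠ (p, p, p) := by
      intro h
      simp only [Prod.mk.injEq] at h
      exact huv (h.1.trans h.2.1.symm)
    obtain ⟨hu, hv, hw⟩ := hnot _ _ _ _ hp ht hne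
    have hu0 : u ≠ ⊥ := fun h => hu (h ▸ bot_le)
    have hv0 : v ≠ ⊥ := fun h => hv (h ▸ bot_le)
    have hw0 : w ≠ ⊥ := fun h => hw (h ▸ bot_le)
    have hwle : w ≤ u ⊔ v := hle _ ht
    simp [bowtie, huv, hu0, hv0, hw0, hwle]

/-- Every element of `R(S)` is the join of the generators `⋈` of its triples. -/
lemma eq_sup_bowtie [SemilatticeSup (RSet S)] [OrderBot (RSet S)]
    (hS : ∀ x y : RSet S, x ≤ y ↔ Rle x y) (x : RSet S) :
    x = x.2.1.toFinset.sup fun t => bowtie t.1 t.2.1 t.2.2 := by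
  apply le_antisymm
  · rw [hS]
    rintro t ⟨htx, ht⟩
    have hle := Finset.le_sup (f := fun t : S × S × S => bowtie t.1 t.2.1 t.2.2)
      (x.2.1.mem_toFinset.2 htx)
    exact (hS _ _).1 hle t ⟨(mem_bowtie_and_forall_mem_bowtie x htx).1, ht⟩
  · refine Finset.sup_le fun t ht => (hS _ _).2 ?_
    rw [Set.Finite.mem_toFinset] at ht
    rintro s ⟨hs, hsx⟩
    rcases (mem_bowtie_and_forall_mem_bowtie x ht).2 s hs with rfl | rfl
    · exact absurd ht hsx
    · exact Or.inl bot_le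

/-- Two `∨,0`-homomorphisms on `R(S)` that agree on the generators `⋈` are equal. -/
lemma eq_of_eq_on_bowtie [SemilatticeSup (RSet S)] [OrderBot (RSet S)]
    (hS : ∀ x y : RSet S, x ≤ y ↔ Rle x y) {M : Type*} [SemilatticeSup M] [OrderBot M]
    {φ ψ : RSet S → M} (hφ0 : φ ⊥ = ⊥) (hφ : ∀ x y, φ (x ⊔ y) = φ x ⊔ φ y)
    (hψ0 : ψ ⊥ = ⊥) (hψ : ∀ x y, ψ (x ⊔ y) = ψ x ⊔ ψ y)
    (h : ∀ u v w : S, w ≤ u ⊔ v → φ (bowtie u v w) = ψ (bowtie u v w)) : φ = ψ := by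
  funext x
  rw [eq_sup_bowtie hS x, Finset.apply_sup_eq_sup_comp φ hφ hφ0,
    Finset.apply_sup_eq_sup_comp ψ hψ hψ0]
  refine Finset.sup_congr rfl fun t ht => h _ _ _ ?_
  exact x.2.2.1 t (x.2.1.mem_toFinset.1 ht)

end Generation

/-- `S ↦ R(S)`, `f ↦ R(f)` is a functor: `R(id) = id` and
`R(g ∘ f) = R(g) ∘ R(f)`. -/
theorem RSet_functorial (S T U : Type*) [SemilatticeSup S] [OrderBot S]
    [SemilatticeSup T] [OrderBot T] [SemilatticeSup U] [OrderBot U]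
    [instS : SemilatticeSup (RSet S)] [instBS : OrderBot (RSet S)]
    [instT : SemilatticeSup (RSet T)] [instBT : OrderBot (RSet T)]
    [instU : SemilatticeSup (RSet U)] [instBU : OrderBot (RSet U)]
    (hS : ∀ x y : RSet S, x ≤ y ↔ Rle x y) (hT : ∀ x y : RSet T, x ≤ y ↔ Rle x y)
    (hU : ∀ x y : RSet U, x ≤ y ↔ Rle x y)
    (f : S → T) (hf0 : f ⊥ = ⊥) (hfsup : ∀ a b : S, f (a ⊔ b) = f a ⊔ f b)
    (g : T → U) (hg0 : g ⊥ = ⊥) (hgsup : ∀ a b : T, g (a ⊔ b) = g a ⊔ g b) :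
    (∀ gid : RSet S → RSet S, IsRMap (id : S → S) gid → gid = id) ∧
    (∀ (gf : RSet S → RSet T) (gg : RSet T → RSet U) (ggf : RSet S → RSet U),
      IsRMap f gf → IsRMap g gg → IsRMap (g ∘ f) ggf → ggf = gg ∘ gf) := by
  refine ⟨fun gid ⟨h0, hsup, _, hb⟩ => ?_, ?_⟩
  · exact eq_of_eq_on_bowtie hS h0 hsup rfl (fun _ _ => rfl) hb
  · rintro gf gg ggf ⟨hf0', hfsup', _, hfb⟩ ⟨hg0', hgsup', _, hgb⟩ ⟨h0, hsup, _, hb⟩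
    refine eq_of_eq_on_bowtie hS h0 hsup ?_ ?_ fun u v w hw => ?_
    · rw [Function.comp_apply, hf0', hg0']
    · intro x y
      simp only [Function.comp_apply, hfsup', hgsup']
    · have hfw : f w ≤ f u ⊔ f v := by
        rw [← hfsup, ← sup_eq_right, ← hfsup, sup_eq_right.2 hw]
      simp only [hb u v w hw, Function.comp_apply, hfb u v w hw, hgb _ _ _ hfw]
end

section
/- Let S be a ∨,0-semilattice and let (S_i)_{i∈I} be a family of ∨,0-subsemilattices of S. Then (1) R(⋂_{i∈I} S_i) = ⋂_{i∈I} R(S_i) and D(⋂_{i∈I} S_i) = ⋂_{i∈I} D(S_i); and (2) if I is a nonempty upward directed poset and (S_i)_{i∈I} is isotone (i ≤ j implies S_i ⊆ S_j), then R(⋃_{i∈I} S_i) = ⋃_{i∈I} R(S_i) and D(⋃_{i∈I} S_i) = ⋃_{i∈I} D(S_i). -/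
section Tower

variable {D : Type*} [SemilatticeSup D] [OrderBot D]

/-- `x` is a reduced finite subset of `C(A)`, for a subset `A` of the ambient
`∨,0`-semilattice `D`. -/
def IsReducedIn (A : Set D) (x : Set (D × D × D)) : Prop :=
  x.Finite ∧
  (∀ t ∈ x, t.1 ∈ A ∧ t.2.1 ∈ A ∧ t.2.2 ∈ A ∧ t.2.2 ≤ t.1 ⊔ t.2.1) ∧
  (∃! u : D, (u, u, u) ∈ x) ∧
  (∀ u v w : D, (u, v, w) ∈ x → (v, u, w) ∈ x → u = v ∧ v = w) ∧
  (∀ p u v w : D, (p, p, p) ∈ x → (u, v, w) ∈ x → (u, v, w) ≠ (p, p, p) →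
    ¬u ≤ p ∧ ¬v ≤ p ∧ ¬w ≤ p)

/-- The coordinate of the (unique, for a reduced set) diagonal triple of `x`. -/
noncomputable def piIn (x : Set (D × D × D)) : D := by
  classical exact if h : ∃ u : D, (u, u, u) ∈ x then h.choose else ⊥

/-- The partial order between reduced sets. -/
def RleIn (x y : Set (D × D × D)) : Prop :=
  ∀ t ∈ x \ y, t.1 ≤ piIn y ∨ t.2.2 ≤ piIn y

/-- A realization, inside an ambient `∨,0`-semilattice `D`, of the increasing chain
`S0 = R⁰(S0) ⊆ R¹(S0) ⊆ R²(S0) ⊆ …` of iterated free distributive extensions whose union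
`D(S0)` is all of `D` : `T n` realizes `Rⁿ(S0)`, and `φ n` is the canonical bijection from
the set of reduced subsets of `C(T n)` onto `T (n+1)`, which is an order-isomorphism
fixing `T n` (identified with the diagonal singletons). -/
structure RTower (D : Type*) [SemilatticeSup D] [OrderBot D] (S0 : Set D) where
  T : ℕ → Set D
  φ : (n : ℕ) → {x : Set (D × D × D) // IsReducedIn (T n) x} → D
  T_zero : T 0 = S0
  bot_mem : ∀ n, (⊥ : D) ∈ T n
  sup_mem : ∀ n, ∀ x ∈ T n, ∀ y ∈ T n, x ⊔ y ∈ T n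
  phi_range : ∀ n, Set.range (φ n) = T (n + 1)
  phi_inj : ∀ n, Function.Injective (φ n)
  phi_diag : ∀ (n : ℕ) (x : {x : Set (D × D × D) // IsReducedIn (T n) x}) (a : D),
    x.1 = {(a, a, a)} → φ n x = a
  phi_le : ∀ (n : ℕ) (x y : {x : Set (D × D × D) // IsReducedIn (T n) x}),
    φ n x ≤ φ n y ↔ RleIn x.1 y.1
  union_univ : (⋃ n, T n) = (Set.univ : Set D)

/-- The realization, inside `D`, of the `n`-th level `Rⁿ(B)` of the free distributive
extension of a `∨,0`-subsemilattice `B ⊆ S0`. -/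
def RTower.FXn {S0 : Set D} (tw : RTower D S0) (B : Set D) : ℕ → Set D
  | 0 => B
  | n + 1 => {d | ∃ x : {x : Set (D × D × D) // IsReducedIn (tw.T n) x},
      tw.φ n x = d ∧ ∀ t ∈ x.1, t.1 ∈ tw.FXn B n ∧ t.2.1 ∈ tw.FXn B n ∧ t.2.2 ∈ tw.FXn B n}

/-- The realization, inside `D`, of the free distributive extension `D(B)` of a
`∨,0`-subsemilattice `B ⊆ S0`. -/
def RTower.FX {S0 : Set D} (tw : RTower D S0) (B : Set D) : Set D := ⋃ n, tw.FXn B n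

end Tower

/-- `R(A)`, for a `∨,0`-subsemilattice `A ⊆ S`, viewed as a subset of `R(S)`:
the reduced sets all of whose entries lie in `A`. -/
def RSub {S : Type*} [SemilatticeSup S] [OrderBot S] (A : Set S) : Set (RSet S) :=
  {x : RSet S | ∀ t ∈ x.1, t.1 ∈ A ∧ t.2.1 ∈ A ∧ t.2.2 ∈ A}

/-- A finite set of triples with entries in a directed union of sets has its entries in one of
these sets. -/
lemma exists_subset_prod_of_subset_prod_iUnion {α ι : Type*} [Nonempty ι] {B : ι → Set α}
    (hB : Directed (· ⊆ ·) B) {x : Set (α × α × α)} (hx : x.Finite)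
    (h : x ⊆ (⋃ i, B i) ×ˢ (⋃ i, B i) ×ˢ (⋃ i, B i)) :
    ∃ i, x ⊆ B i ×ˢ B i ×ˢ B i := by
  induction x, hx using Set.Finite.induction_on with
  | empty => exact ⟨Classical.arbitrary ι, Set.empty_subset _⟩
  | @insert t s _ _ ih =>
    obtain ⟨i, hi⟩ := ih ((Set.subset_insert _ _).trans h)
    obtain ⟨h₁, h₂, h₃⟩ := h (Set.mem_insert t s)
    obtain ⟨a, ha⟩ := Set.mem_iUnion.1 h₁
    obtain ⟨b, hb⟩ := Set.mem_iUnion.1 h₂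
    obtain ⟨c, hc⟩ := Set.mem_iUnion.1 h₃
    obtain ⟨j, hij, haj⟩ := hB i a
    obtain ⟨k, hbk, hck⟩ := hB b c
    obtain ⟨l, hjl, hkl⟩ := hB j k
    have hil := hij.trans hjl
    exact ⟨l, Set.insert_subset ⟨hjl (haj ha), hkl (hbk hb), hkl (hck hc)⟩
      (hi.trans (Set.prod_mono hil (Set.prod_mono hil hil)))⟩

section RSub

variable {S ι : Type*} [SemilatticeSup S] [OrderBot S]

lemma RSub_mono {A B : Set S} (h : A ⊆ B) : RSub A ⊆ RSub B :=
  fun _ hx t ht => ⟨h (hx t ht).1, h (hx t ht).2.1, h (hx t ht).2.2⟩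

lemma RSub_iInter (A : ι → Set S) : RSub (⋂ i, A i) = ⋂ i, RSub (A i) := by
  ext x
  simp only [RSub, Set.mem_ofPred_eq, Set.mem_iInter]
  grind

lemma RSub_iUnion_of_directed [Nonempty ι] {A : ι → Set S} (hA : Directed (· ⊆ ·) A) :
    RSub (⋃ i, A i) = ⋃ i, RSub (A i) := by
  apply Set.Subset.antisymm
  · intro x hx
    exact Set.mem_iUnion.2 (exists_subset_prod_of_subset_prod_iUnion hA x.2.1 hx)
  · exact Set.iUnion_subset fun i => RSub_mono (Set.subset_iUnion A i)

end RSub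

namespace RTower

variable {D ι : Type*} [SemilatticeSup D] [OrderBot D] {S0 : Set D} (tw : RTower D S0)

lemma isReducedIn_singleton {A : Set D} {a : D} (ha : a ∈ A) :
    IsReducedIn A {(a, a, a)} := by
  obtain ⟨h₁, h₂, h₃⟩ := isReduced_singleton a
  exact ⟨h₁, fun t ht => by obtain rfl := ht; exact ⟨ha, ha, ha, le_sup_left⟩, h₃⟩

lemma mem_FXn_succ {B : Set D} {n : ℕ} {d : D} :
    d ∈ tw.FXn B (n + 1) ↔ ∃ x : {x : Set (D × D × D) // IsReducedIn (tw.T n) x},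
      tw.φ n x = d ∧ x.1 ⊆ tw.FXn B n ×ˢ tw.FXn B n ×ˢ tw.FXn B n :=
  Iff.rfl

lemma φ_mem_FXn_succ {B : Set D} {n : ℕ} {x : {x : Set (D × D × D) // IsReducedIn (tw.T n) x}} :
    tw.φ n x ∈ tw.FXn B (n + 1) ↔ x.1 ⊆ tw.FXn B n ×ˢ tw.FXn B n ×ˢ tw.FXn B n := by
  rw [mem_FXn_succ]
  constructor
  · rintro ⟨y, hy, hyB⟩
    rwa [← tw.phi_inj n hy]
  · exact fun h => ⟨x, rfl, h⟩

lemma T_mono : Monotone tw.T :=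
  monotone_nat_of_le_succ fun n d hd => by
    rw [← tw.phi_range n]
    exact ⟨⟨_, isReducedIn_singleton hd⟩, tw.phi_diag n _ d rfl⟩

lemma FXn_mono {B C : Set D} (h : B ⊆ C) (n : ℕ) : tw.FXn B n ⊆ tw.FXn C n := by
  induction n with
  | zero => exact h
  | succ n ih =>
    rintro _ ⟨x, rfl, hx⟩
    exact tw.φ_mem_FXn_succ.2 (Set.Subset.trans hx (Set.prod_mono ih (Set.prod_mono ih ih)))

lemma FXn_subset_T {B : Set D} (hB : B ⊆ S0) (n : ℕ) : tw.FXn B n ⊆ tw.T n := by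
  cases n with
  | zero => exact hB.trans tw.T_zero.ge
  | succ n =>
    rintro _ ⟨x, rfl, -⟩
    exact tw.phi_range n ▸ Set.mem_range_self x

/-- An element of `Rⁿ(S)` lies in `Rⁿ⁺¹(B)` exactly when it lies in `Rⁿ(B)`. -/
lemma mem_FXn_succ_iff_of_mem_T {B : Set D} {n : ℕ} {d : D} (hd : d ∈ tw.T n) :
    d ∈ tw.FXn B (n + 1) ↔ d ∈ tw.FXn B n := by
  have h := tw.φ_mem_FXn_succ (B := B) (x := ⟨_, isReducedIn_singleton hd⟩)
  rw [tw.phi_diag n _ d rfl] at h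
  simpa using h

lemma mem_FXn_iff_of_mem_T {B : Set D} {n m : ℕ} (hnm : n ≤ m) {d : D} (hd : d ∈ tw.T n) :
    d ∈ tw.FXn B m ↔ d ∈ tw.FXn B n := by
  induction m, hnm using Nat.le_induction with
  | base => rfl
  | succ m hnm ih => rw [tw.mem_FXn_succ_iff_of_mem_T (tw.T_mono hnm hd), ih]

lemma mem_FX_iff_of_mem_T {B : Set D} (hB : B ⊆ S0) {n : ℕ} {d : D} (hd : d ∈ tw.T n) :
    d ∈ tw.FX B ↔ d ∈ tw.FXn B n := by
  refine ⟨fun h => ?_, fun h => Set.mem_iUnion.2 ⟨n, h⟩⟩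
  obtain ⟨m, hm⟩ := Set.mem_iUnion.1 h
  rcases le_total n m with hnm | hmn
  · exact (tw.mem_FXn_iff_of_mem_T hnm hd).1 hm
  · exact (tw.mem_FXn_iff_of_mem_T hmn (tw.FXn_subset_T hB m hm)).2 hm

lemma FXn_inter_iInter (B : ι → Set D) (n : ℕ) :
    tw.FXn (S0 ∩ ⋂ i, B i) n = tw.T n ∩ ⋂ i, tw.FXn (B i) n := by
  induction n with
  | zero => rw [tw.T_zero]; rfl
  | succ n ih =>
    apply Set.Subset.antisymm
    · exact Set.subset_inter (tw.FXn_subset_T Set.inter_subset_left _) (Set.subset_iInter fun i =>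
        tw.FXn_mono (Set.inter_subset_right.trans (Set.iInter_subset B i)) _)
    · rintro d ⟨hd, hdB⟩
      rw [← tw.phi_range n] at hd
      obtain ⟨x, rfl⟩ := hd
      simp only [Set.mem_iInter, φ_mem_FXn_succ] at hdB
      rw [φ_mem_FXn_succ, ih]
      intro t ht
      obtain ⟨h₁, h₂, h₃, -⟩ := x.2.2.1 t ht
      exact ⟨⟨h₁, Set.mem_iInter.2 fun i => (hdB i ht).1⟩,
        ⟨h₂, Set.mem_iInter.2 fun i => (hdB i ht).2.1⟩,
        ⟨h₃, Set.mem_iInter.2 fun i => (hdB i ht).2.2⟩⟩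

lemma FX_inter_iInter {B : ι → Set D} (hB : ∀ i, B i ⊆ S0) :
    tw.FX (S0 ∩ ⋂ i, B i) = ⋂ i, tw.FX (B i) := by
  ext d
  obtain ⟨n, hn⟩ := Set.mem_iUnion.1 (tw.union_univ.ge (Set.mem_univ d))
  rw [tw.mem_FX_iff_of_mem_T Set.inter_subset_left hn, FXn_inter_iInter]
  simp only [Set.mem_inter_iff, Set.mem_iInter, hn, true_and, tw.mem_FX_iff_of_mem_T (hB _) hn]

lemma FXn_iUnion_of_directed [Nonempty ι] {B : ι → Set D} (hB : Directed (· ⊆ ·) B) (n : ℕ) :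
    tw.FXn (⋃ i, B i) n = ⋃ i, tw.FXn (B i) n := by
  induction n with
  | zero => rfl
  | succ n ih =>
    apply Set.Subset.antisymm
    · rintro _ ⟨x, rfl, hx⟩
      rw [ih] at hx
      obtain ⟨i, hi⟩ := exists_subset_prod_of_subset_prod_iUnion
        (hB.mono_comp (g := fun C => tw.FXn C n) (· ⊆ ·) fun _ _ h => tw.FXn_mono h n) x.2.1 hx
      exact Set.mem_iUnion.2 ⟨i, tw.φ_mem_FXn_succ.2 hi⟩
    · exact Set.iUnion_subset fun i => tw.FXn_mono (Set.subset_iUnion B i) _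

lemma FX_iUnion_of_directed [Nonempty ι] {B : ι → Set D} (hB : Directed (· ⊆ ·) B) :
    tw.FX (⋃ i, B i) = ⋃ i, tw.FX (B i) := by
  simp only [FX, tw.FXn_iUnion_of_directed hB]
  exact Set.iUnion_comm _

end RTower

/-- for a family `(Aᵢ)` of `∨,0`-subsemilattices of `S`,
`R(⋂ Aᵢ) = ⋂ R(Aᵢ)` and `D(⋂ Aᵢ) = ⋂ D(Aᵢ)`; and if the family is isotone over a
nonempty upward directed index poset, `R(⋃ Aᵢ) = ⋃ R(Aᵢ)` and `D(⋃ Aᵢ) = ⋃ D(Aᵢ)`.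
Here `D(S)` is realized by an `RTower` on an ambient semilattice `D`, over the image of a
`∨,0`-embedding `e : S → D`, and `D(A) ⊆ D` is `RTower.FX` applied to `e '' A`. -/
theorem R_and_D_of_intersections_and_directed_unions (S : Type*) [SemilatticeSup S]
    [OrderBot S] {ι : Type*} [Preorder ι] (A : ι → Set S)
    (hA : ∀ i, (⊥ : S) ∈ A i ∧ ∀ x ∈ A i, ∀ y ∈ A i, x ⊔ y ∈ A i)
    (D : Type*) [SemilatticeSup D] [OrderBot D]
    (e : S → D) (heinj : Function.Injective e) (he0 : e ⊥ = ⊥)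
    (hesup : ∀ a b : S, e (a ⊔ b) = e a ⊔ e b)
    (tw : RTower D (Set.range e)) :
    (RSub (⋂ i, A i) = ⋂ i, RSub (A i)) ∧
    (tw.FX (e '' ⋂ i, A i) = ⋂ i, tw.FX (e '' A i)) ∧
    (Nonempty ι → (∀ i j : ι, ∃ k, i ≤ k ∧ j ≤ k) → (∀ i j : ι, i ≤ j → A i ⊆ A j) →
      (RSub (⋃ i, A i) = ⋃ i, RSub (A i)) ∧
      tw.FX (e '' ⋃ i, A i) = ⋃ i, tw.FX (e '' A i)) := by
  refine ⟨RSub_iInter A, ?_, fun _ hdir hmono => ?_⟩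
  · have h : e '' ⋂ i, A i = Set.range e ∩ ⋂ i, e '' A i := by
      ext d
      constructor
      · rintro ⟨a, ha, rfl⟩
        exact ⟨⟨a, rfl⟩, Set.mem_iInter.2 fun i => ⟨a, Set.mem_iInter.1 ha i, rfl⟩⟩
      · rintro ⟨⟨a, rfl⟩, ha⟩
        exact ⟨a, Set.mem_iInter.2 fun i => (heinj.mem_set_image).1 (Set.mem_iInter.1 ha i), rfl⟩
    rw [h, tw.FX_inter_iInter fun i => Set.image_subset_range e (A i)]
  · have hA' : Directed (· ⊆ ·) A := fun i j =>
      let ⟨k, hik, hjk⟩ := hdir i j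
      ⟨k, hmono i k hik, hmono j k hjk⟩
    refine ⟨RSub_iUnion_of_directed hA', ?_⟩
    rw [Set.image_iUnion]
    exact tw.FX_iUnion_of_directed
      (hA'.mono_comp (g := fun C => e '' C) (· ⊆ ·) fun _ _ h => Set.image_mono h)
end

section
/- Let Λ be a chain and let (X_i)_{i∈I} be a family of subsets of Λ. Then (1) S(⋂_{i∈I} X_i) = ⋂_{i∈I} S(X_i); and (2) if I is a nonempty upward directed poset and (X_i)_{i∈I} is isotone (i ≤ j implies X_i ⊆ X_j), then S(⋃_{i∈I} X_i) = ⋃_{i∈I} S(X_i). -/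
section SLam

/-- A realization, inside an ambient `∨,0`-semilattice `D`, of the `∨,0`-semilattice `S(Λ)`
presented by generators `a`, `b`, `cᵢ` (for `i ∈ Λ`) and relations `cᵢ ≤ a ⊔ b` and
`cᵢ ≤ c j` for `i ≤ j`: the listed conditions say exactly that the `∨,0`-subsemilattice
generated by `a`, `b` and the `cᵢ` is freely presented by those relations. -/
structure SLamData (D : Type*) [SemilatticeSup D] [OrderBot D]
    (Λ : Type*) [LinearOrder Λ] where
  a : D
  b : D
  c : Λ → D
  c_mono : Monotone c
  c_le_ab : ∀ i, c i ≤ a ⊔ b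
  not_a_le : ∀ i, ¬ a ≤ b ⊔ c i
  not_b_le : ∀ i, ¬ b ≤ a ⊔ c i
  not_a_le_b : ¬ a ≤ b
  not_b_le_a : ¬ b ≤ a
  not_c_le_a : ∀ i, ¬ c i ≤ a
  not_c_le_b : ∀ i, ¬ c i ≤ b
  c_le_a_sup_c : ∀ i j, c i ≤ a ⊔ c j → i ≤ j
  c_le_b_sup_c : ∀ i j, c i ≤ b ⊔ c j → i ≤ j

/-- The `∨,0`-subsemilattice `S(X)` of `S(Λ)` generated by `{0, a, b, a ⊔ b} ∪ {cᵢ : i ∈ X}`,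
realized inside the ambient semilattice `D`. -/
def SLamData.SX {D : Type*} [SemilatticeSup D] [OrderBot D] {Λ : Type*} [LinearOrder Λ]
    (sd : SLamData D Λ) (X : Set Λ) : Set D :=
  supClosure ({⊥, sd.a, sd.b, sd.a ⊔ sd.b} ∪ sd.c '' X)

end SLam

namespace SLamData

variable {D : Type*} [SemilatticeSup D] [OrderBot D] {Λ : Type*} [LinearOrder Λ]

/-- The elements of `S(Λ)` whose normal form involves the generator `c i`. -/
def HasIndex (sd : SLamData D Λ) (x : D) (i : Λ) : Prop :=
  x = sd.c i ∨ x = sd.a ⊔ sd.c i ∨ x = sd.b ⊔ sd.c i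

/-- The `∨,0`-subsemilattice generated by `a` and `b`. -/
def base (sd : SLamData D Λ) : Set D :=
  {⊥, sd.a, sd.b, sd.a ⊔ sd.b}

theorem supClosed_base (sd : SLamData D Λ) : SupClosed sd.base := by
  rintro x (rfl | rfl | rfl | rfl) y (rfl | rfl | rfl | rfl) <;>
    simp [base, sup_comm]

theorem supClosed_insert_bot_image_c (sd : SLamData D Λ) (X : Set Λ) :
    SupClosed (insert ⊥ (sd.c '' X)) := by
  rintro x (rfl | ⟨i, hi, rfl⟩) y (rfl | ⟨j, hj, rfl⟩)
  · simp
  · exact Or.inr ⟨j, hj, by simp⟩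
  · exact Or.inr ⟨i, hi, by simp⟩
  · rcases le_total i j with h | h
    · exact Or.inr ⟨j, hj, (sup_eq_right.2 (sd.c_mono h)).symm⟩
    · exact Or.inr ⟨i, hi, (sup_eq_left.2 (sd.c_mono h)).symm⟩

theorem exists_sup_of_mem_SX (sd : SLamData D Λ) {X : Set Λ} {x : D} (hx : x ∈ sd.SX X) :
    ∃ e ∈ sd.base, ∃ f ∈ insert ⊥ (sd.c '' X), e ⊔ f = x := by
  refine supClosure_min (t := {x | ∃ e ∈ sd.base, ∃ f ∈ insert ⊥ (sd.c '' X), e ⊔ f = x})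
    ?_ ?_ hx
  · rintro y (hy | hy)
    · exact ⟨y, hy, ⊥, Or.inl rfl, sup_bot_eq y⟩
    · exact ⟨⊥, Or.inl rfl, y, Or.inr hy, bot_sup_eq y⟩
  · rintro _ ⟨e, he, f, hf, rfl⟩ _ ⟨e', he', f', hf', rfl⟩
    exact ⟨e ⊔ e', sd.supClosed_base he he', f ⊔ f',
      sd.supClosed_insert_bot_image_c X hf hf', sup_sup_sup_comm e e' f f'⟩

theorem mem_SX_iff (sd : SLamData D Λ) {X : Set Λ} {x : D} :
    x ∈ sd.SX X ↔ x ∈ sd.base ∨ ∃ i ∈ X, sd.HasIndex x i := by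
  constructor
  · intro hx
    obtain ⟨e, he, f, rfl | ⟨i, hi, rfl⟩, rfl⟩ := sd.exists_sup_of_mem_SX hx
    · exact Or.inl (by simpa using he)
    · rcases he with rfl | rfl | rfl | rfl
      · exact Or.inr ⟨i, hi, Or.inl (bot_sup_eq _)⟩
      · exact Or.inr ⟨i, hi, Or.inr (Or.inl rfl)⟩
      · exact Or.inr ⟨i, hi, Or.inr (Or.inr rfl)⟩
      · rw [sup_eq_left.2 (sd.c_le_ab i)]
        exact Or.inl (by simp [base])
  · have hbase : sd.base ⊆ sd.SX X := fun _ h ↦ subset_supClosure (Or.inl h)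
    rintro (hx | ⟨i, hi, hx⟩)
    · exact hbase hx
    · have hc : sd.c i ∈ sd.SX X := subset_supClosure (Or.inr ⟨i, hi, rfl⟩)
      rcases hx with rfl | rfl | rfl
      · exact hc
      · exact supClosed_supClosure (hbase (by simp [base])) hc
      · exact supClosed_supClosure (hbase (by simp [base])) hc

theorem HasIndex.c_le {sd : SLamData D Λ} {x : D} {i : Λ} (h : sd.HasIndex x i) :
    sd.c i ≤ x := by
  rcases h with rfl | rfl | rfl <;> simp

theorem HasIndex.le_sup {sd : SLamData D Λ} {x : D} {i : Λ} (h : sd.HasIndex x i) :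
    x ≤ sd.a ⊔ sd.c i ∨ x ≤ sd.b ⊔ sd.c i := by
  rcases h with rfl | rfl | rfl <;> simp

theorem HasIndex.le_of_hasIndex {sd : SLamData D Λ} {x : D} {i j : Λ}
    (hi : sd.HasIndex x i) (hj : sd.HasIndex x j) : i ≤ j :=
  hj.le_sup.elim (fun h ↦ sd.c_le_a_sup_c i j (hi.c_le.trans h))
    (fun h ↦ sd.c_le_b_sup_c i j (hi.c_le.trans h))

theorem HasIndex.unique {sd : SLamData D Λ} {x : D} {i j : Λ}
    (hi : sd.HasIndex x i) (hj : sd.HasIndex x j) : i = j :=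
  le_antisymm (hi.le_of_hasIndex hj) (hj.le_of_hasIndex hi)

theorem HasIndex.notMem_base {sd : SLamData D Λ} {x : D} {i : Λ} (h : sd.HasIndex x i) :
    x ∉ sd.base := by
  rintro (rfl | rfl | rfl | rfl)
  · exact sd.not_c_le_a i (h.c_le.trans bot_le)
  · exact sd.not_c_le_a i h.c_le
  · exact sd.not_c_le_b i h.c_le
  · exact h.le_sup.elim (fun h ↦ sd.not_b_le i (le_sup_right.trans h))
      (fun h ↦ sd.not_a_le i (le_sup_left.trans h))

theorem HasIndex.mem_SX_iff {sd : SLamData D Λ} {X : Set Λ} {x : D} {i : Λ}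
    (h : sd.HasIndex x i) : x ∈ sd.SX X ↔ i ∈ X := by
  rw [SLamData.mem_SX_iff]
  constructor
  · rintro (hx | ⟨j, hj, hx⟩)
    · exact absurd hx h.notMem_base
    · exact h.unique hx ▸ hj
  · exact fun hi ↦ Or.inr ⟨i, hi, h⟩

end SLamData

/-- for a family `(Xᵢ)` of subsets of a chain `Λ`,
`S(⋂ Xᵢ) = ⋂ S(Xᵢ)`, and `S(⋃ Xᵢ) = ⋃ S(Xᵢ)` for an isotone family over a nonempty
upward directed index poset.  The ambient semilattice `D` realizes `S(Λ)` itself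
(hypothesis `hfull`). -/
theorem SX_of_intersections_and_directed_unions (Λ : Type*) [LinearOrder Λ]
    (D : Type*) [SemilatticeSup D] [OrderBot D] (sd : SLamData D Λ)
    (hfull : sd.SX Set.univ = Set.univ)
    {ι : Type*} [Preorder ι] (X : ι → Set Λ) :
    (sd.SX (⋂ i, X i) = ⋂ i, sd.SX (X i)) ∧
    (Nonempty ι → (∀ i j : ι, ∃ k, i ≤ k ∧ j ≤ k) → (∀ i j : ι, i ≤ j → X i ⊆ X j) →
      sd.SX (⋃ i, X i) = ⋃ i, sd.SX (X i)) := by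
  have normalForm (x : D) : x ∈ sd.base ∨ ∃ i, sd.HasIndex x i := by
    have hx : x ∈ sd.SX Set.univ := hfull ▸ Set.mem_univ x
    simpa using sd.mem_SX_iff.1 hx
  refine ⟨?_, fun hne _ _ ↦ ?_⟩ <;> ext x <;> rcases normalForm x with hx | ⟨i, hx⟩
  · simp [sd.mem_SX_iff, hx]
  · simp [hx.mem_SX_iff]
  · simp [sd.mem_SX_iff, hx]
  · simp [hx.mem_SX_iff]
end

section
/- Let Λ be a chain. For every x ∈ F(Λ) there exists a least (with respect to inclusion) subset X of Λ such that x ∈ F(X), and this least subset is finite. -/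
section Support

/-- Every element of `S(X)` is `0`, `a`, `b`, `a ⊔ b`, or one of `cᵢ`, `a ⊔ cᵢ`, `b ⊔ cᵢ`
with `i ∈ X`. -/
theorem SLamData.mem_SX_cases {D : Type*} [SemilatticeSup D] [OrderBot D] {Λ : Type*}
    [LinearOrder Λ] (sd : SLamData D Λ) {X : Set Λ} {d : D} (hd : d ∈ sd.SX X) :
    (d = ⊥ ∨ d = sd.a ∨ d = sd.b ∨ d = sd.a ⊔ sd.b) ∨
      ∃ i ∈ X, d = sd.c i ∨ d = sd.a ⊔ sd.c i ∨ d = sd.b ⊔ sd.c i := by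
  let P : Set D := {d | (d = ⊥ ∨ d = sd.a ∨ d = sd.b ∨ d = sd.a ⊔ sd.b) ∨
      ∃ i ∈ X, d = sd.c i ∨ d = sd.a ⊔ sd.c i ∨ d = sd.b ⊔ sd.c i}
  have cc : ∀ i ∈ X, ∀ j ∈ X, ∃ k ∈ X, sd.c i ⊔ sd.c j = sd.c k := by
    intro i hi j hj
    rcases le_total i j with h | h
    · exact ⟨j, hj, sup_eq_right.2 (sd.c_mono h)⟩
    · exact ⟨i, hi, sup_eq_left.2 (sd.c_mono h)⟩
  have abc : ∀ i, sd.a ⊔ sd.b ⊔ sd.c i = sd.a ⊔ sd.b := fun i => sup_eq_left.2 (sd.c_le_ab i)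
  have top : ∀ e ∈ P, e ≤ sd.a ⊔ sd.b := by
    rintro e ((rfl | rfl | rfl | rfl) | ⟨i, -, rfl | rfl | rfl⟩) <;> simp [sd.c_le_ab]
  have absorb : ∀ e ∈ P, sd.a ⊔ sd.b ⊔ e ∈ P := fun e he =>
    Or.inl (by rw [sup_eq_left.2 (top e he)]; simp)
  have sup_a : ∀ e ∈ P, sd.a ⊔ e ∈ P := by
    rintro e ((rfl | rfl | rfl | rfl) | ⟨i, hi, rfl | rfl | rfl⟩)
    · exact Or.inl (by simp)
    · exact Or.inl (by simp)
    · exact Or.inl (by simp)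
    · exact Or.inl (by simp)
    · exact Or.inr ⟨i, hi, by simp⟩
    · exact Or.inr ⟨i, hi, by simp⟩
    · exact Or.inl (by rw [← sup_assoc, abc]; simp)
  have sup_b : ∀ e ∈ P, sd.b ⊔ e ∈ P := by
    rintro e ((rfl | rfl | rfl | rfl) | ⟨i, hi, rfl | rfl | rfl⟩)
    · exact Or.inl (by simp)
    · exact Or.inl (by simp [sup_comm])
    · exact Or.inl (by simp)
    · exact Or.inl (by simp)
    · exact Or.inr ⟨i, hi, by simp⟩
    · exact Or.inl (by rw [← sup_assoc, sup_comm sd.b, abc]; simp)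
    · exact Or.inr ⟨i, hi, by simp⟩
  have sup_c : ∀ i ∈ X, ∀ e ∈ P, sd.c i ⊔ e ∈ P := by
    rintro i hi e ((rfl | rfl | rfl | rfl) | ⟨j, hj, h⟩)
    · exact Or.inr ⟨i, hi, by simp⟩
    · exact Or.inr ⟨i, hi, by simp [sup_comm]⟩
    · exact Or.inr ⟨i, hi, by simp [sup_comm]⟩
    · exact Or.inl (by rw [sup_comm, abc]; simp)
    · obtain ⟨k, hk, hc⟩ := cc i hi j hj
      refine Or.inr ⟨k, hk, ?_⟩
      rcases h with rfl | rfl | rfl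
      · exact Or.inl hc
      · exact Or.inr (Or.inl (by rw [sup_left_comm, hc]))
      · exact Or.inr (Or.inr (by rw [sup_left_comm, hc]))
  have hP : SupClosed P := by
    rintro d ((rfl | rfl | rfl | rfl) | ⟨i, hi, rfl | rfl | rfl⟩) e he
    · simpa using he
    · exact sup_a e he
    · exact sup_b e he
    · exact absorb e he
    · exact sup_c i hi e he
    · rw [sup_assoc]; exact sup_a _ (sup_c i hi e he)
    · rw [sup_assoc]; exact sup_b _ (sup_c i hi e he)
  refine supClosure_min ?_ hP hd
  rintro e ((rfl | rfl | rfl | rfl) | ⟨i, hi, rfl⟩)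
  · exact Or.inl (by simp)
  · exact Or.inl (by simp)
  · exact Or.inl (by simp)
  · exact Or.inl (by simp)
  · exact Or.inr ⟨i, hi, Or.inl rfl⟩

theorem SLamData.SX_mono {D : Type*} [SemilatticeSup D] [OrderBot D] {Λ : Type*}
    [LinearOrder Λ] (sd : SLamData D Λ) {X Y : Set Λ} (h : X ⊆ Y) : sd.SX X ⊆ sd.SX Y :=
  supClosure_mono (Set.union_subset_union_right _ (Set.image_mono h))

theorem SLamData.mem_of_mem_SX {D : Type*} [SemilatticeSup D] [OrderBot D] {Λ : Type*}
    [LinearOrder Λ] (sd : SLamData D Λ) {Y : Set Λ} {d : D} {i : Λ}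
    (h : d = sd.c i ∨ d = sd.a ⊔ sd.c i ∨ d = sd.b ⊔ sd.c i) (hd : d ∈ sd.SX Y) : i ∈ Y := by
  have hci : sd.c i ≤ d := by rcases h with rfl | rfl | rfl <;> simp
  have hab : d ≠ sd.a ⊔ sd.b := by
    rintro hd
    rcases h with h | h | h
    · exact sd.not_a_le i ((le_sup_left.trans (hd.symm.trans h).le).trans le_sup_right)
    · exact sd.not_b_le i (le_sup_right.trans (hd.symm.trans h).le)
    · exact sd.not_a_le i (le_sup_left.trans (hd.symm.trans h).le)
  rcases sd.mem_SX_cases hd with (rfl | rfl | rfl | rfl) | ⟨j, hj, hdj⟩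
  · exact absurd (hci.trans bot_le) (sd.not_c_le_a i)
  · exact absurd hci (sd.not_c_le_a i)
  · exact absurd hci (sd.not_c_le_b i)
  · exact absurd rfl hab
  have hcj : sd.c j ≤ d := by rcases hdj with rfl | rfl | rfl <;> simp
  have hle : ∀ k l, (d = sd.c k ∨ d = sd.a ⊔ sd.c k ∨ d = sd.b ⊔ sd.c k) →
      sd.c l ≤ d → l ≤ k := by
    rintro k l (rfl | rfl | rfl) hl
    · exact sd.c_le_a_sup_c l k (hl.trans le_sup_right)
    · exact sd.c_le_a_sup_c l k hl
    · exact sd.c_le_b_sup_c l k hl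
  rwa [le_antisymm (hle j i hdj hci) (hle i j h hcj)]

theorem SLamData.exists_least_support {D : Type*} [SemilatticeSup D] [OrderBot D] {Λ : Type*}
    [LinearOrder Λ] (sd : SLamData D Λ) {d : D} (hd : d ∈ sd.SX Set.univ) :
    ∃ X : Set Λ, X.Finite ∧ d ∈ sd.SX X ∧ ∀ Y : Set Λ, d ∈ sd.SX Y → X ⊆ Y := by
  rcases sd.mem_SX_cases hd with h | ⟨i, -, h⟩
  · exact ⟨∅, Set.finite_empty, subset_supClosure (Or.inl h), fun Y _ => Set.empty_subset Y⟩
  · refine ⟨{i}, Set.finite_singleton i, ?_,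
      fun Y hY => Set.singleton_subset_iff.2 (sd.mem_of_mem_SX h hY)⟩
    have hc : sd.c i ∈ sd.SX {i} := subset_supClosure (Or.inr ⟨i, rfl, rfl⟩)
    have ha : sd.a ∈ sd.SX {i} := subset_supClosure (Or.inl (by simp))
    have hb : sd.b ∈ sd.SX {i} := subset_supClosure (Or.inl (by simp))
    rcases h with rfl | rfl | rfl
    · exact hc
    · exact supClosed_supClosure ha hc
    · exact supClosed_supClosure hb hc

theorem isReducedIn_singleton {D : Type*} [SemilatticeSup D] {A : Set D} {d : D} (hd : d ∈ A) :
    IsReducedIn A {(d, d, d)} := by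
  refine ⟨Set.finite_singleton _, ?_, ⟨d, rfl, ?_⟩, ?_, ?_⟩
  · rintro t rfl
    exact ⟨hd, hd, hd, le_sup_left⟩
  · intro u hu
    simpa using hu
  · intro u v w h _
    simp only [Set.mem_singleton_iff, Prod.mk.injEq] at h
    obtain ⟨rfl, rfl, rfl⟩ := h
    exact ⟨rfl, rfl⟩
  · intro p u v w hp hu hne
    exact absurd (Eq.trans hu (Eq.symm hp)) hne

variable {D : Type*} [SemilatticeSup D] [OrderBot D] {S0 : Set D}

theorem RTower.T_mono_s8 (tw : RTower D S0) : Monotone tw.T :=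
  monotone_nat_of_le_succ fun n d hd => by
    rw [← tw.phi_range n]
    exact ⟨⟨_, isReducedIn_singleton hd⟩, tw.phi_diag n _ d rfl⟩

theorem RTower.FXn_mono_s8 (tw : RTower D S0) {B C : Set D} (h : B ⊆ C) (n : ℕ) :
    tw.FXn B n ⊆ tw.FXn C n := by
  induction n with
  | zero => exact h
  | succ n ih =>
    rintro d ⟨x, hx, ht⟩
    exact ⟨x, hx, fun t htx => ⟨ih (ht t htx).1, ih (ht t htx).2.1, ih (ht t htx).2.2⟩⟩

/-- For `d` in `Rⁿ(S0)`, membership in `Rⁿ⁺¹(B)` and in `Rⁿ(B)` are equivalent. -/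
theorem RTower.mem_FXn_succ_iff (tw : RTower D S0) {B : Set D} {n : ℕ} {d : D}
    (hd : d ∈ tw.T n) : d ∈ tw.FXn B (n + 1) ↔ d ∈ tw.FXn B n := by
  have hdiag := tw.phi_diag n ⟨_, isReducedIn_singleton hd⟩ d rfl
  constructor
  · rintro ⟨x, hx, ht⟩
    obtain rfl := tw.phi_inj n (hx.trans hdiag.symm)
    exact (ht (d, d, d) rfl).1
  · intro h
    refine ⟨_, hdiag, ?_⟩
    rintro t rfl
    exact ⟨h, h, h⟩

theorem RTower.mem_FX_iff (tw : RTower D S0) {B : Set D} (hB : B ⊆ S0) {n : ℕ} {d : D}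
    (hd : d ∈ tw.T n) : d ∈ tw.FX B ↔ d ∈ tw.FXn B n := by
  refine ⟨fun h => ?_, fun h => Set.mem_iUnion.2 ⟨n, h⟩⟩
  obtain ⟨m, hm⟩ := Set.mem_iUnion.1 h
  have up : ∀ k l, k ≤ l → d ∈ tw.T k → (d ∈ tw.FXn B l ↔ d ∈ tw.FXn B k) := by
    intro k l hkl hk
    induction l, hkl using Nat.le_induction with
    | base => rfl
    | succ l hkl ih => rw [tw.mem_FXn_succ_iff (tw.T_mono_s8 hkl hk), ih]
  rcases le_total n m with h' | h'
  · exact (up n m h' hd).1 hm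
  · refine (up m n h' ?_).2 hm
    cases m with
    | zero => rw [tw.T_zero]; exact hB hm
    | succ m =>
      obtain ⟨x, rfl, -⟩ := hm
      rw [← tw.phi_range m]
      exact ⟨x, rfl⟩

theorem RTower.exists_least_support_of_mem_T {Λ : Type*} [LinearOrder Λ] (sd : SLamData D Λ)
    (tw : RTower D (sd.SX Set.univ)) (n : ℕ) :
    ∀ d ∈ tw.T n, ∃ X : Set Λ, X.Finite ∧ d ∈ tw.FXn (sd.SX X) n ∧
      ∀ Y : Set Λ, d ∈ tw.FXn (sd.SX Y) n → X ⊆ Y := by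
  induction n with
  | zero =>
    intro d hd
    rw [tw.T_zero] at hd
    exact sd.exists_least_support hd
  | succ n ih =>
    intro d hd
    rw [← tw.phi_range n] at hd
    obtain ⟨x, rfl⟩ := hd
    choose! s hfin hmem hleast using ih
    have hT := x.2.2.1
    have key : ∀ t ∈ x.1, s t.1 ∪ s t.2.1 ∪ s t.2.2 ⊆
        ⋃ t ∈ x.1, (s t.1 ∪ s t.2.1 ∪ s t.2.2) := fun t ht =>
      Set.subset_biUnion_of_mem (u := fun t : D × D × D => s t.1 ∪ s t.2.1 ∪ s t.2.2) ht
    refine ⟨⋃ t ∈ x.1, (s t.1 ∪ s t.2.1 ∪ s t.2.2), ?_, ⟨x, rfl, fun t ht => ?_⟩, ?_⟩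
    · refine x.2.1.biUnion fun t ht => ?_
      obtain ⟨h1, h2, h3, -⟩ := hT t ht
      exact ((hfin _ h1).union (hfin _ h2)).union (hfin _ h3)
    · obtain ⟨h1, h2, h3, -⟩ := hT t ht
      have hsub := key t ht
      simp only [Set.union_subset_iff] at hsub
      exact ⟨tw.FXn_mono_s8 (sd.SX_mono hsub.1.1) n (hmem _ h1),
        tw.FXn_mono_s8 (sd.SX_mono hsub.1.2) n (hmem _ h2),
        tw.FXn_mono_s8 (sd.SX_mono hsub.2) n (hmem _ h3)⟩
    · rintro Y ⟨y, hy, hY⟩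
      obtain rfl := tw.phi_inj n hy
      refine Set.iUnion₂_subset fun t ht => ?_
      obtain ⟨h1, h2, h3, -⟩ := hT t ht
      obtain ⟨k1, k2, k3⟩ := hY t ht
      exact Set.union_subset (Set.union_subset (hleast _ h1 Y k1) (hleast _ h2 Y k2))
        (hleast _ h3 Y k3)

end Support

/-- every element of `F(Λ) = D(S(Λ))` has a least (finite) support:
a least subset `X ⊆ Λ` with `x ∈ F(X)`, and this `X` is finite. -/
theorem exists_least_finite_support (Λ : Type*) [LinearOrder Λ]
    (D : Type*) [SemilatticeSup D] [OrderBot D]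
    (sd : SLamData D Λ) (tw : RTower D (sd.SX Set.univ)) (x : D) :
    ∃ X : Set Λ, X.Finite ∧ x ∈ tw.FX (sd.SX X) ∧
      ∀ Y : Set Λ, x ∈ tw.FX (sd.SX Y) → X ⊆ Y := by
  obtain ⟨n, hn⟩ := Set.mem_iUnion.1 (tw.union_univ.symm ▸ Set.mem_univ x)
  obtain ⟨X, hfin, hX, hleast⟩ := RTower.exists_least_support_of_mem_T sd tw n x hn
  have hiff : ∀ Y : Set Λ, x ∈ tw.FX (sd.SX Y) ↔ x ∈ tw.FXn (sd.SX Y) n := fun Y =>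
    tw.mem_FX_iff (sd.SX_mono (Set.subset_univ Y)) hn
  exact ⟨X, hfin, (hiff X).2 hX, fun Y hY => hleast Y ((hiff Y).1 hY)⟩
end

section
/- Let S be a strongly distributive ∨,0-semilattice. Then for all a, b ∈ S, every chain Λ, and every isotone Λ-indexed sequence (c_i)_{i∈Λ} of elements of S such that c_i ≤ a ∨ b for all i ∈ Λ, there exist isotone Λ-indexed sequences (a_i)_{i∈Λ} and (b_i)_{i∈Λ} of elements of S such that a_i ≤ a, b_i ≤ b, and c_i = a_i ∨ b_i for all i ∈ Λ. -/
/-- In a distributive join-semilattice, join-irreducible elements are join-prime. -/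
lemma SupIrred.supPrime_of_refinement {S : Type*} [SemilatticeSup S]
    (hdist : ∀ x y z : S, z ≤ x ⊔ y → ∃ u v : S, u ≤ x ∧ v ≤ y ∧ z = u ⊔ v)
    {p : S} (hp : SupIrred p) : SupPrime p := by
  refine ⟨hp.1, fun x y h => ?_⟩
  obtain ⟨u, v, hu, hv, huv⟩ := hdist x y p h
  rcases hp.2 huv.symm with rfl | rfl
  · exact Or.inl hu
  · exact Or.inr hv

/-- Given finite sets `M i` indexed by a chain, increasing for the domination preorder, whose
elements satisfy `q true` or `q false` for lower sets `q _`, the elements of all `M i` can be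
coloured compatibly with `q`, in such a way that for `i ≤ j` in a given finite set of indices,
each element of `M i` lies below an element of `M j` of the same colour. -/
lemma exists_coloring_of_finset {S Λ : Type*} [Preorder S] [LinearOrder Λ] (M : Λ → Finset S)
    (hM : ∀ i j, i ≤ j → ∀ p ∈ M i, ∃ r ∈ M j, p ≤ r)
    (q : Bool → LowerSet S) (hq : ∀ i, ∀ p ∈ M i, ∃ k, p ∈ q k) (s : Finset Λ) :
    ∃ χ : ∀ i, M i → Bool, (∀ i p, (p : S) ∈ q (χ i p)) ∧
      ∀ i ∈ s, ∀ j ∈ s, i ≤ j → ∀ p : M i, ∃ r : M j, (p : S) ≤ r ∧ χ i p = χ j r := by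
  classical
  induction s using Finset.induction_on_min with
  | empty =>
    choose χ hχ using fun (i : Λ) (p : M i) => hq i p p.2
    exact ⟨χ, hχ, by simp⟩
  | insert m s hm ih =>
    obtain ⟨χ, hχ, hmono⟩ := ih
    rcases s.eq_empty_or_nonempty with rfl | hs
    · refine ⟨χ, hχ, fun i hi j hj _ p => ?_⟩
      obtain rfl : i = m := by simpa using hi
      obtain rfl : j = i := by simpa using hj
      exact ⟨p, le_rfl, rfl⟩
    · set n := s.min' hs
      have hn : n ∈ s := s.min'_mem hs
      have hup : ∀ p : M m, ∃ r : M n, (p : S) ≤ r := fun p => by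
        obtain ⟨r, hr, hpr⟩ := hM m n (hm n hn).le p p.2
        exact ⟨⟨r, hr⟩, hpr⟩
      choose f hf using hup
      have hne : ∀ i ∈ s, i ≠ m := fun i hi => (hm i hi).ne'
      refine ⟨Function.update χ m fun p => χ n (f p), fun i p => ?_, fun i hi j hj hij p => ?_⟩
      · by_cases h : i = m
        · subst h
          rw [Function.update_self]
          exact (q _).lower (hf p) (hχ n (f p))
        · rw [Function.update_of_ne h]
          exact hχ i p
      · rcases Finset.mem_insert.1 hi with rfl | his
        · rcases Finset.mem_insert.1 hj with rfl | hj
          · exact ⟨p, le_rfl, rfl⟩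
          · obtain ⟨r, hr, hc⟩ := hmono n hn j hj (s.min'_le j hj) (f p)
            refine ⟨r, (hf p).trans hr, ?_⟩
            rw [Function.update_self, Function.update_of_ne (hne j hj)]
            exact hc
        · rcases Finset.mem_insert.1 hj with rfl | hj
          · exact absurd (hm i his) hij.not_gt
          · rw [Function.update_of_ne (hne i his), Function.update_of_ne (hne j hj)]
            exact hmono i his j hj hij p

/-- The compactness extension of `exists_coloring_of_finset` to the whole chain of indices. -/
lemma exists_coloring {S Λ : Type*} [Preorder S] [LinearOrder Λ] (M : Λ → Finset S)
    (hM : ∀ i j, i ≤ j → ∀ p ∈ M i, ∃ r ∈ M j, p ≤ r)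
    (q : Bool → LowerSet S) (hq : ∀ i, ∀ p ∈ M i, ∃ k, p ∈ q k) :
    ∃ χ : ∀ i, M i → Bool, (∀ i p, (p : S) ∈ q (χ i p)) ∧
      ∀ i j, i ≤ j → ∀ p : M i, ∃ r : M j, (p : S) ≤ r ∧ χ i p = χ j r := by
  classical
  choose g hgq hg using exists_coloring_of_finset M hM q hq
  obtain ⟨χ, hχ⟩ := Finset.rado_selection g
  refine ⟨χ, fun i p => ?_, fun i j hij p => ?_⟩
  · obtain ⟨t, -, ht⟩ := hχ {i}
    rw [ht i (by simp)]
    exact hgq t i p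
  · obtain ⟨t, hst, ht⟩ := hχ {i, j}
    rw [ht i (by simp), ht j (by simp)]
    exact hg t i (hst (by simp)) j (hst (by simp)) hij p

/-- the monotone refinement property for a strongly distributive
`∨,0`-semilattice (a distributive `∨,0`-semilattice each of whose elements is a finite
join of join-irreducible elements). -/
theorem monotone_refinement_of_stronglyDistributive (S : Type*) [SemilatticeSup S]
    [OrderBot S]
    (hdist : ∀ x y z : S, z ≤ x ⊔ y → ∃ u v : S, u ≤ x ∧ v ≤ y ∧ z = u ⊔ v)
    (hstrong : ∀ s : S, ∃ F : Finset S, (∀ x ∈ F, SupIrred x) ∧ s = F.sup id)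
    (a b : S) (Λ : Type*) [LinearOrder Λ] (c : Λ → S)
    (hmono : Monotone c) (hc : ∀ i, c i ≤ a ⊔ b) :
    ∃ A B : Λ → S, Monotone A ∧ Monotone B ∧
      ∀ i, A i ≤ a ∧ B i ≤ b ∧ c i = A i ⊔ B i := by
  choose M hirr hsup using fun i => hstrong (c i)
  have hprime : ∀ i, ∀ p ∈ M i, SupPrime p := fun i p hp =>
    (hirr i p hp).supPrime_of_refinement hdist
  have hle : ∀ i, ∀ p ∈ M i, p ≤ c i := fun i p hp => by
    rw [hsup i]
    exact Finset.le_sup (f := id) hp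
  obtain ⟨χ, hχ, hχmono⟩ := exists_coloring M
    (fun i j hij p hp => (hprime i p hp).le_finset_sup.1
      (((hle i p hp).trans (hmono hij)).trans_eq (hsup j)))
    (fun k => LowerSet.Iic (cond k a b))
    (fun i p hp => ((hprime i p hp).2 ((hle i p hp).trans (hc i))).elim
      (fun h => ⟨true, h⟩) (fun h => ⟨false, h⟩))
  let C (k : Bool) (i : Λ) : S := (Finset.univ.filter fun p : M i => χ i p = k).sup Subtype.val
  have hleC : ∀ i (p : M i), (p : S) ≤ C (χ i p) i := fun i p =>
    Finset.le_sup (f := Subtype.val) (by simp)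
  have hCmono : ∀ k, Monotone (C k) := fun k i j hij => Finset.sup_le fun p hp => by
    obtain ⟨r, hr, hpr⟩ := hχmono i j hij p
    obtain rfl : χ i p = k := by simpa using hp
    exact hr.trans (hpr ▸ hleC j r)
  have hCle : ∀ k i, C k i ≤ cond k a b := fun k i => Finset.sup_le fun p hp => by
    obtain rfl : χ i p = k := by simpa using hp
    exact hχ i p
  have hCc : ∀ k i, C k i ≤ c i := fun k i => Finset.sup_le fun p _ => hle i p p.2
  refine ⟨C true, C false, hCmono true, hCmono false, fun i =>
    ⟨hCle true i, hCle false i, le_antisymm ?_ (sup_le (hCc true i) (hCc false i))⟩⟩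
  rw [hsup i]
  refine Finset.sup_le fun p hp => (hleC i ⟨p, hp⟩).trans ?_
  cases χ i ⟨p, hp⟩
  · exact le_sup_right
  · exact le_sup_left
end

section
/- Let S be a countable distributive ∨,0-semilattice. Then for all a, b ∈ S, every chain Λ, and every isotone Λ-indexed sequence (c_i)_{i∈Λ} of elements of S such that c_i ≤ a ∨ b for all i ∈ Λ, there exist isotone Λ-indexed sequences (a_i)_{i∈Λ} and (b_i)_{i∈Λ} of elements of S such that a_i ≤ a, b_i ≤ b, and c_i = a_i ∨ b_i for all i ∈ Λ. -/
/-- A finite approximation to a monotone refinement: a finite chain of pairs below `(a, b)`,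
containing `(a, b)`, whose joins are comparable with every element of `C`. -/
structure IsFiniteRefinement {S : Type*} [SemilatticeSup S] (a b : S) (C : Set S)
    (G : Finset (S × S)) : Prop where
  top_mem : (a, b) ∈ G
  le_top : ∀ p ∈ G, p ≤ (a, b)
  total : ∀ p ∈ G, ∀ q ∈ G, p ≤ q ∨ q ≤ p
  comparable : ∀ p ∈ G, ∀ x ∈ C, p.1 ⊔ p.2 ≤ x ∨ x ≤ p.1 ⊔ p.2

/-- A finite approximation can be enlarged so as to decompose a given element of the chain. -/
theorem IsFiniteRefinement.exists_extension {S : Type*} [SemilatticeSup S] [OrderBot S]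
    (hdist : ∀ x y z : S, z ≤ x ⊔ y → ∃ u v : S, u ≤ x ∧ v ≤ y ∧ z = u ⊔ v)
    {a b : S} {C : Set S} (hC : ∀ x ∈ C, ∀ y ∈ C, x ≤ y ∨ y ≤ x)
    {G : Finset (S × S)} (hG : IsFiniteRefinement a b C G)
    {x : S} (hx : x ∈ C) (hxab : x ≤ a ⊔ b) :
    ∃ G', IsFiniteRefinement a b C G' ∧ G ⊆ G' ∧ ∃ p ∈ G', p.1 ⊔ p.2 = x := by
  classical
  obtain ⟨m, hm⟩ := (G.filter fun p => x ≤ p.1 ⊔ p.2).exists_minimal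
    ⟨(a, b), by simpa using ⟨hG.top_mem, hxab⟩⟩
  obtain ⟨hmG, hxm⟩ := Finset.mem_filter.1 hm.prop
  have hm_le : ∀ q ∈ G, x ≤ q.1 ⊔ q.2 → m ≤ q := fun q hq hxq =>
    (hG.total m hmG q hq).elim id (hm.le_of_le (Finset.mem_filter.2 ⟨hq, hxq⟩))
  let l : S × S := (G.filter fun p => ¬ x ≤ p.1 ⊔ p.2).sup id
  have le_l : ∀ q ∈ G, ¬ x ≤ q.1 ⊔ q.2 → q ≤ l := fun q hq hxq =>
    Finset.le_sup (f := id) (Finset.mem_filter.2 ⟨hq, hxq⟩)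
  have hlm : l ≤ m := by
    refine Finset.sup_le fun q hq => ?_
    obtain ⟨hqG, hxq⟩ := Finset.mem_filter.1 hq
    exact (hG.total q hqG m hmG).elim id fun h =>
      absurd (hxm.trans (sup_le_sup h.1 h.2)) hxq
  have hlx : l ≤ (x, x) := by
    refine Finset.sup_le fun q hq => ?_
    obtain ⟨hqG, hxq⟩ := Finset.mem_filter.1 hq
    have h := (hG.comparable q hqG x hx).resolve_right hxq
    exact ⟨le_sup_left.trans h, le_sup_right.trans h⟩
  obtain ⟨u, v, hu, hv, hxuv⟩ := hdist m.1 m.2 x hxm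
  have hpm : l ⊔ (u, v) ≤ m := sup_le hlm ⟨hu, hv⟩
  have hpx : (l ⊔ (u, v)).1 ⊔ (l ⊔ (u, v)).2 = x := by
    apply le_antisymm
    · exact sup_le (sup_le hlx.1 (hxuv ▸ le_sup_left)) (sup_le hlx.2 (hxuv ▸ le_sup_right))
    · rw [hxuv]
      exact sup_le_sup le_sup_right le_sup_right
  have hp_total : ∀ q ∈ G, l ⊔ (u, v) ≤ q ∨ q ≤ l ⊔ (u, v) := fun q hq => by
    by_cases hxq : x ≤ q.1 ⊔ q.2
    · exact Or.inl (hpm.trans (hm_le q hq hxq))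
    · exact Or.inr ((le_l q hq hxq).trans le_sup_left)
  refine ⟨insert (l ⊔ (u, v)) G, ⟨?_, ?_, ?_, ?_⟩, Finset.subset_insert _ _,
    _, Finset.mem_insert_self _ _, hpx⟩
  · exact Finset.mem_insert_of_mem hG.top_mem
  · exact (Finset.forall_mem_insert _ _ _).2 ⟨hpm.trans (hG.le_top m hmG), hG.le_top⟩
  · refine (Finset.forall_mem_insert _ _ _).2 ⟨?_, fun q hq => ?_⟩
    · exact (Finset.forall_mem_insert _ _ _).2 ⟨Or.inl le_rfl, hp_total⟩
    · exact (Finset.forall_mem_insert _ _ _).2 ⟨(hp_total q hq).symm, hG.total q hq⟩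
  · refine (Finset.forall_mem_insert _ _ _).2 ⟨fun y hy => ?_, hG.comparable⟩
    rw [hpx]
    exact hC x hx y hy

/-- the monotone refinement property for a countable distributive
`∨,0`-semilattice. -/
theorem monotone_refinement_of_countable (S : Type*) [SemilatticeSup S] [OrderBot S]
    [Countable S]
    (hdist : ∀ x y z : S, z ≤ x ⊔ y → ∃ u v : S, u ≤ x ∧ v ≤ y ∧ z = u ⊔ v)
    (a b : S) (Λ : Type*) [LinearOrder Λ] (c : Λ → S)
    (hmono : Monotone c) (hc : ∀ i, c i ≤ a ⊔ b) :
    ∃ A B : Λ → S, Monotone A ∧ Monotone B ∧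
      ∀ i, A i ≤ a ∧ B i ≤ b ∧ c i = A i ⊔ B i := by
  have hC : ∀ x ∈ Set.range c, ∀ y ∈ Set.range c, x ≤ y ∨ y ≤ x := by
    rintro _ ⟨i, rfl⟩ _ ⟨j, rfl⟩
    exact (le_total i j).imp (@hmono i j) (@hmono j i)
  have hbase : IsFiniteRefinement a b (Set.range c) {(a, b)} :=
    ⟨by simp, by simp, by simp, by
      rintro p hp _ ⟨i, rfl⟩
      rw [Finset.mem_singleton.1 hp]
      exact Or.inr (hc i)⟩
  let P := {G : Finset (S × S) // IsFiniteRefinement a b (Set.range c) G}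
  let D : Set.range c → Order.Cofinal P := fun x =>
    { carrier := {G | ∃ p ∈ G.1, p.1 ⊔ p.2 = x.1}
      isCofinal := fun G => by
        obtain ⟨i, hi⟩ := x.2
        obtain ⟨G', hG', hle, hp⟩ := G.2.exists_extension hdist hC x.2 (hi ▸ hc i)
        exact ⟨⟨G', hG'⟩, hp, hle⟩ }
  let _ : Encodable (Set.range c) := Encodable.ofCountable _
  let I : Order.Ideal P := Order.idealOfCofinals ⟨_, hbase⟩ D
  have hI : ∀ x : Set.range c, ∃ p : S × S, (∃ G ∈ I, p ∈ G.1) ∧ p.1 ⊔ p.2 = x.1 := fun x => by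
    obtain ⟨G, ⟨p, hp, hpx⟩, hGI⟩ := Order.cofinal_meets_idealOfCofinals ⟨_, hbase⟩ D x
    exact ⟨p, ⟨G, hGI, hp⟩, hpx⟩
  choose f hf hfx using hI
  have hf_mono : Monotone f := fun x y hxy => by
    obtain ⟨G, hG, hxG⟩ := hf x
    obtain ⟨H, hH, hyH⟩ := hf y
    obtain ⟨K, -, hGK, hHK⟩ := I.directed G hG H hH
    refine (K.2.total _ (hGK hxG) _ (hHK hyH)).elim id fun h => ?_
    have hyx : y ≤ x := by
      rw [← Subtype.coe_le_coe, ← hfx x, ← hfx y]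
      exact sup_le_sup h.1 h.2
    exact (congrArg f (le_antisymm hxy hyx)).le
  have hg_mono : Monotone fun i => f ⟨c i, i, rfl⟩ := fun i j hij => hf_mono (hmono hij)
  refine ⟨fun i => (f ⟨c i, i, rfl⟩).1, fun i => (f ⟨c i, i, rfl⟩).2,
    fun i j hij => (hg_mono hij).1, fun i j hij => (hg_mono hij).2, fun i => ?_⟩
  obtain ⟨G, -, hG⟩ := hf ⟨c i, i, rfl⟩
  have h := G.2.le_top _ hG
  exact ⟨h.1, h.2, (hfx ⟨c i, i, rfl⟩).symm⟩
end
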